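/- arXiv:1412.4971 — 2 statements merged into one kernel-verified Lean document; each statement's English description precedes it below -/
import Mathlib

section
/- Let $n \ge 2$ be an integer. For every $t \ge 1$, $P_n(t) \le \left(t+\sqrt{t^2-1}\right)^{\frac{n(2n-1)}{2(n-1)}}\left(t+(2n-1)\sqrt{t^2-1}\right)^{-\frac{n}{2(n-1)}}$. -/
open Real Polynomial

/-- The `n`-th Legendre polynomial, via the Rodrigues formula
`P_n = (1/(2ⁿ n!)) dⁿ/dtⁿ [(t²-1)ⁿ]`. -/
noncomputable def legendreP (n : ℕ) : Polynomial ℝ :=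
  (1 / (2 ^ n * (Nat.factorial n : ℝ))) •
    (fun q : Polynomial ℝ => Polynomial.derivative q)^[n] ((X ^ 2 - 1) ^ n)

/-- The differential equation satisfied by the derivatives of `(X² - 1)ⁿ`. -/
lemma iterate_derivative_X_sq_sub_one_pow_ode (n k : ℕ) :
    (X ^ 2 - 1 : ℝ[X]) * derivative^[k + 2] ((X ^ 2 - 1) ^ n)
      + C (2 * ((k : ℝ) + 1 - n)) * X * derivative^[k + 1] ((X ^ 2 - 1) ^ n)
      + C (((k : ℝ) + 1) * (k - 2 * n)) * derivative^[k] ((X ^ 2 - 1) ^ n) = 0 := by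
  induction k with
  | zero =>
    have h1 : (X ^ 2 - 1 : ℝ[X]) * derivative ((X ^ 2 - 1) ^ n)
        = C (2 * (n : ℝ)) * X * (X ^ 2 - 1) ^ n := by
      rcases n with _ | n
      · simp
      · simp only [derivative_pow, derivative_sub, derivative_X, derivative_one,
          Nat.add_sub_cancel, map_mul, Nat.cast_succ, map_add, map_one, map_natCast]
        rw [show (C (2 : ℝ) : ℝ[X]) = 2 from rfl]
        push_cast
        ring
    have h2 := congrArg derivative h1
    simp only [derivative_mul, derivative_sub, derivative_X_pow, derivative_one, derivative_C,
      derivative_X] at h2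
    simp only [Function.iterate_succ_apply', Function.iterate_zero_apply, zero_add]
    simp only [map_mul, map_sub, map_add, map_one, map_natCast, map_ofNat, Nat.cast_ofNat,
      CharP.cast_eq_zero, map_zero] at h2 ⊢
    linear_combination h2
  | succ k ih =>
    have h2 := congrArg derivative ih
    simp only [derivative_mul, derivative_sub, derivative_add, derivative_X_pow, derivative_one,
      derivative_C, derivative_X, derivative_zero, ← Function.iterate_succ_apply'] at h2
    simp only [map_mul, map_sub, map_add, map_one, map_natCast, map_ofNat, Nat.cast_ofNat,
      Nat.cast_succ] at h2 ⊢
    simp only [Nat.succ_eq_add_one] at h2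
    linear_combination h2

/-- Legendre's differential equation. -/
lemma legendreP_ode (n : ℕ) (t : ℝ) :
    (t ^ 2 - 1) * (derivative (derivative (legendreP n))).eval t
      + 2 * t * (derivative (legendreP n)).eval t = n * (n + 1) * (legendreP n).eval t := by
  have h := congrArg (eval t) (iterate_derivative_X_sq_sub_one_pow_ode n n)
  simp only [Function.iterate_succ_apply', eval_add, eval_mul, eval_sub, eval_pow, eval_X,
    eval_one, eval_C, eval_zero] at h
  simp only [legendreP, derivative_smul, eval_smul, smul_eq_mul]
  linear_combination (1 / (2 ^ n * (n.factorial : ℝ))) * h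

lemma legendreP_eval_eq_sum (n : ℕ) (t : ℝ) :
    (legendreP n).eval t = 1 / (2 ^ n * (n.factorial : ℝ)) *
      ∑ k ∈ Finset.range (n + 1), (n.choose k : ℝ) *
        ((n.descFactorial (n - k) * (t - 1) ^ (n - (n - k))) *
          (n.descFactorial k * (t + 1) ^ (n - k))) := by
  have h : (X ^ 2 - 1 : ℝ[X]) ^ n = (X - C 1) ^ n * (X + C 1) ^ n := by
    rw [← mul_pow]
    congr 1
    simp only [map_one]
    ring
  simp only [legendreP, h, eval_smul, smul_eq_mul]
  congr 1
  refine (congrArg (eval t) (iterate_derivative_mul _ _)).trans ?_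
  simp [eval_finsetSum, iterate_derivative_X_sub_pow, iterate_derivative_X_add_pow,
    -map_one]

lemma legendreP_eval_nonneg (n : ℕ) {t : ℝ} (ht : 1 ≤ t) : 0 ≤ (legendreP n).eval t := by
  have h : 0 ≤ t - 1 := sub_nonneg.2 ht
  rw [legendreP_eval_eq_sum]
  positivity

lemma legendreP_eval_one (n : ℕ) : (legendreP n).eval 1 = 1 := by
  rw [legendreP_eval_eq_sum, Finset.sum_eq_single 0]
  · have := n.factorial_ne_zero
    simp [Nat.descFactorial_self]
    norm_num
    field_simp
  · intro k hk hk0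
    have : n - (n - k) ≠ 0 := by
      have := Finset.mem_range.1 hk
      omega
    simp [this]
  · simp

/-- In hyperbolic coordinates, `Pₙ` is bounded by a supersolution of Legendre's equation. -/
lemma legendreP_eval_cosh_le (n : ℕ) (hn : 2 ≤ n) {u : ℝ} (hu : 0 ≤ u) :
    (legendreP n).eval (cosh u) ≤
      exp ((n : ℝ) * (2 * n - 1) / (2 * (n - 1)) * u
        - (n : ℝ) / (2 * (n - 1)) * log (cosh u + (2 * n - 1) * sinh u)) := by
  have hn' : (2 : ℝ) ≤ n := by exact_mod_cast hn
  have hn1 : (n : ℝ) - 1 ≠ 0 := by linarith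
  set A : ℝ → ℝ := fun x => cosh x + (2 * n - 1) * sinh x with hA
  set G : ℝ → ℝ := fun x => exp ((n : ℝ) * (2 * n - 1) / (2 * (n - 1)) * x
        - (n : ℝ) / (2 * (n - 1)) * log (A x)) with hG
  set W : ℝ → ℝ := fun x => 2 * n ^ 2 * sinh x / A x with hW
  set f : ℝ → ℝ := fun x => (legendreP n).eval (cosh x) with hf
  set f' : ℝ → ℝ := fun x => (derivative (legendreP n)).eval (cosh x) * sinh x with hf'
  have hApos : ∀ x, 0 ≤ x → 0 < A x := fun x hx => by
    have := sinh_nonneg_iff.2 hx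
    have := cosh_pos x
    have : 0 ≤ (2 * (n : ℝ) - 1) * sinh x := mul_nonneg (by linarith) (by assumption)
    simp only [hA]
    linarith
  have hdA : ∀ x, HasDerivAt A (sinh x + (2 * n - 1) * cosh x) x := fun x =>
    (hasDerivAt_cosh x).add ((hasDerivAt_sinh x).const_mul _)
  have hdG : ∀ x, 0 ≤ x → HasDerivAt G (G x * W x) x := fun x hx => by
    have hpos := hApos x hx
    refine ((((hasDerivAt_id x).const_mul _).sub
      (((hdA x).log hpos.ne').const_mul _)).exp).congr_deriv ?_
    simp only [hG, hW, id]
    congr 1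
    field_simp
    simp only [hA]
    ring
  have hdW : ∀ x, 0 ≤ x → HasDerivAt W (2 * n ^ 2 / A x ^ 2) x := fun x hx => by
    have hpos := hApos x hx
    refine (((hasDerivAt_sinh x).const_mul _).div (hdA x) hpos.ne').congr_deriv ?_
    congr 1
    simp only [hA]
    linear_combination 2 * (n : ℝ) ^ 2 * cosh_sq x
  have hdf : ∀ x, HasDerivAt f (f' x) x := fun x =>
    ((legendreP n).hasDerivAt (cosh x)).comp x (hasDerivAt_cosh x)
  have hdf' : ∀ x, HasDerivAt f' ((derivative (derivative (legendreP n))).eval (cosh x)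
      * sinh x * sinh x + (derivative (legendreP n)).eval (cosh x) * cosh x) x := fun x =>
    (((derivative (legendreP n)).hasDerivAt (cosh x)).comp x (hasDerivAt_cosh x)).mul
      (hasDerivAt_sinh x)
  have hf0 : ∀ x, 0 ≤ f x := fun x => legendreP_eval_nonneg n (one_le_cosh x)
  have hdD : ∀ x, 0 ≤ x → HasDerivAt (fun x => G x * (sinh x * (W x * f x - f' x)))
      (G x * f x * (sinh x * (2 * n ^ 2 / A x ^ 2 + W x ^ 2) + cosh x * W x
        - n * (n + 1) * sinh x)) x := fun x hx => by
    refine ((hdG x hx).mul ((hasDerivAt_sinh x).mul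
      (((hdW x hx).mul (hdf x)).sub (hdf' x)))).congr_deriv ?_
    have hode := legendreP_ode n (cosh x)
    have hsq := cosh_sq x
    simp only [hf, hf', Pi.mul_apply, Pi.sub_apply]
    linear_combination (-G x * sinh x) * hode
      + (G x * sinh x * (derivative (derivative (legendreP n))).eval (cosh x)) * hsq
  have hsuper : ∀ x, 0 ≤ x → 0 ≤ sinh x * (2 * n ^ 2 / A x ^ 2 + W x ^ 2) + cosh x * W x
        - n * (n + 1) * sinh x := fun x hx => by
    have hpos := hApos x hx
    have hs := sinh_nonneg_iff.2 hx
    have hcs := sinh_lt_cosh x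
    have key : sinh x * (2 * n ^ 2 / A x ^ 2 + W x ^ 2) + cosh x * W x - n * (n + 1) * sinh x
        = sinh x * n * ((cosh x - sinh x) * ((3 * n - 1) * cosh x - (n - 1) * sinh x))
          / A x ^ 2 := by
      simp only [hW]
      field_simp
      simp only [hA]
      linear_combination (-2 * (n : ℝ) * sinh x) * cosh_sq x
    rw [key]
    have h1 : 0 ≤ (3 * (n : ℝ) - 1) * cosh x - (n - 1) * sinh x := by nlinarith
    have h2 : 0 ≤ cosh x - sinh x := by linarith
    positivity
  have hmono : MonotoneOn (fun x => G x * (sinh x * (W x * f x - f' x))) (Set.Ici 0) := by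
    refine monotoneOn_of_hasDerivWithinAt_nonneg (convex_Ici 0)
      (fun x hx => (hdD x hx).continuousAt.continuousWithinAt)
      (fun x hx => (hdD x (interior_subset hx)).hasDerivWithinAt) fun x hx => ?_
    have := hsuper x (interior_subset hx)
    have := hf0 x
    have : 0 < G x := exp_pos _
    positivity
  have hw : ∀ x, 0 < x → f' x ≤ W x * f x := fun x hx => by
    have h := hmono Set.self_mem_Ici (Set.mem_Ici.2 hx.le) hx.le
    simp only [sinh_zero, zero_mul, mul_zero] at h
    have hs := sinh_pos_iff.2 hx
    have hGx : 0 < G x := exp_pos _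
    exact sub_nonneg.1 (nonneg_of_mul_nonneg_right (nonneg_of_mul_nonneg_right h hGx) hs)
  have hdq : ∀ x, 0 ≤ x → HasDerivAt (fun x => f x / G x)
      ((f' x * G x - f x * (G x * W x)) / G x ^ 2) x := fun x hx =>
    (hdf x).div (hdG x hx) (exp_pos _).ne'
  have hanti : AntitoneOn (fun x => f x / G x) (Set.Ici 0) := by
    refine antitoneOn_of_hasDerivWithinAt_nonpos (convex_Ici 0)
      (fun x hx => (hdq x hx).continuousAt.continuousWithinAt)
      (fun x hx => (hdq x (interior_subset hx)).hasDerivWithinAt) fun x hx => ?_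
    rw [interior_Ici, Set.mem_Ioi] at hx
    have hGx : 0 < G x := exp_pos _
    refine div_nonpos_of_nonpos_of_nonneg ?_ (by positivity)
    linarith [mul_le_mul_of_nonneg_right (hw x hx) hGx.le]
  have h := hanti Set.self_mem_Ici (Set.mem_Ici.2 hu) hu
  have h0 : f 0 / G 0 = 1 := by simp [hf, hG, hA, legendreP_eval_one]
  simp only [h0] at h
  exact (div_le_one (exp_pos _)).1 h

/-- For every integer `n ≥ 2` and every `t ≥ 1`,
`P_n(t) ≤ (t+√(t²-1))^{n(2n-1)/(2(n-1))} (t + (2n-1)√(t²-1))^{-n/(2(n-1))}`. -/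
theorem legendre_upper_bound_weak (n : ℕ) (hn : 2 ≤ n) :
    ∀ t : ℝ, 1 ≤ t →
      (legendreP n).eval t ≤
        (t + Real.sqrt (t ^ 2 - 1)) ^
            (((n : ℝ) * (2 * (n : ℝ) - 1)) / (2 * ((n : ℝ) - 1))) *
        (t + (2 * (n : ℝ) - 1) * Real.sqrt (t ^ 2 - 1)) ^
            (-((n : ℝ) / (2 * ((n : ℝ) - 1)))) := by
  intro t ht
  obtain ⟨u, hu, rfl⟩ : ∃ u, 0 ≤ u ∧ cosh u = t :=
    ⟨arsinh √(t ^ 2 - 1), arsinh_nonneg_iff.2 (sqrt_nonneg _), by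
      rw [cosh_arsinh, sq_sqrt (by nlinarith), add_sub_cancel, sqrt_sq (by linarith)]⟩
  have hs : √(cosh u ^ 2 - 1) = sinh u := by
    rw [cosh_sq, add_sub_cancel_right, sqrt_sq (sinh_nonneg_iff.2 hu)]
  have hn' : (2 : ℝ) ≤ n := by exact_mod_cast hn
  have hA : 0 < cosh u + (2 * (n : ℝ) - 1) * sinh u :=
    add_pos_of_pos_of_nonneg (cosh_pos u)
      (mul_nonneg (by linarith) (sinh_nonneg_iff.2 hu))
  rw [hs, cosh_add_sinh, ← exp_mul, rpow_def_of_pos hA, ← exp_add]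
  refine (legendreP_eval_cosh_le n hn hu).trans_eq (congrArg exp ?_)
  ring
end

section
/- Let $n$ be a positive integer and define $Q_n(x,y) = F_n(x)F_n(y)$ for $(x,y) \in [0,1]^2$. The following three statements are equivalent: (i) $\log F_n$ is convex on $[0,1]$; (ii) $Q_n$ is convex on $[0,1]^2$; (iii) $\log Q_n$ is convex on $[0,1]^2$. -/
open Real Set

/-- `F n x = ∑_{k=0}^n C(n,k)² x^{2k} (1-x)^{2(n-k)}`, the sum of the squares of the
Bernstein basis polynomials. -/
noncomputable def bernsteinF (n : ℕ) (x : ℝ) : ℝ :=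
  ∑ k ∈ Finset.range (n + 1),
    (Nat.choose n k : ℝ) ^ 2 * x ^ (2 * k) * (1 - x) ^ (2 * (n - k))

/-- A midpoint convex function that is continuous on a convex set is convex there. -/
theorem convexOn_of_continuousOn_of_midpoint {E : Type*} [AddCommGroup E] [Module ℝ E]
    [TopologicalSpace E] [ContinuousAdd E] [ContinuousSMul ℝ E] {s : Set E} {f : E → ℝ}
    (hs : Convex ℝ s) (hf : ContinuousOn f s)
    (hmid : ∀ x ∈ s, ∀ y ∈ s, 2 * f ((1 / 2 : ℝ) • x + (1 / 2 : ℝ) • y) ≤ f x + f y) :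
    ConvexOn ℝ s f := by
  refine ⟨hs, fun x hx y hy a b ha hb hab => ?_⟩
  set c : ℝ → E := fun t => (1 - t) • x + t • y with hc
  have hcs : MapsTo c (Icc 0 1) s := fun t ht =>
    hs hx hy (by linarith [ht.2]) ht.1 (by ring)
  set h : ℝ → ℝ := fun t => f (c t) - ((1 - t) * f x + t * f y) with hh
  have hcont : ContinuousOn h (Icc 0 1) := by
    have hcc : Continuous c := by fun_prop
    exact (hf.comp hcc.continuousOn hcs).sub (by fun_prop)
  have h0 : h 0 = 0 := by simp [hh, hc]
  have h1 : h 1 = 0 := by simp [hh, hc]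
  have hmid' : ∀ u ∈ Icc (0 : ℝ) 1, ∀ v ∈ Icc (0 : ℝ) 1, 2 * h ((u + v) / 2) ≤ h u + h v := by
    intro u hu v hv
    have key := hmid _ (hcs hu) _ (hcs hv)
    have hcuv : (1 / 2 : ℝ) • c u + (1 / 2 : ℝ) • c v = c ((u + v) / 2) := by
      simp only [hc]
      module
    rw [hcuv] at key
    simp only [hh]
    linarith
  obtain ⟨t, ht, hmax⟩ := isCompact_Icc.exists_isMaxOn (nonempty_Icc.2 zero_le_one) hcont
  have hle : ∀ u ∈ Icc (0 : ℝ) 1, h u ≤ h t := fun u hu => hmax hu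
  have hnonpos : h t ≤ 0 := by
    rcases le_total t (1 / 2) with h2 | h2
    · have hu : 2 * t ∈ Icc (0 : ℝ) 1 := ⟨by linarith [ht.1], by linarith⟩
      have key := hmid' 0 (by simp) (2 * t) hu
      rw [show (0 + 2 * t) / 2 = t by ring] at key
      linarith [hle _ hu]
    · have hu : 2 * t - 1 ∈ Icc (0 : ℝ) 1 := ⟨by linarith, by linarith [ht.2]⟩
      have key := hmid' 1 (by simp) (2 * t - 1) hu
      rw [show (1 + (2 * t - 1)) / 2 = t by ring] at key
      linarith [hle _ hu]
  have hb' := (hle b ⟨hb, by linarith⟩).trans hnonpos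
  obtain rfl : a = 1 - b := by linarith
  simpa [hh, hc] using hb'

theorem bernsteinF_pos (n : ℕ) (x : ℝ) : 0 < bernsteinF n x := by
  have hnonneg : ∀ k ∈ Finset.range (n + 1),
      0 ≤ (Nat.choose n k : ℝ) ^ 2 * x ^ (2 * k) * (1 - x) ^ (2 * (n - k)) := by
    intro k _
    simp only [pow_mul]
    positivity
  by_cases hx : x = 0
  · refine Finset.sum_pos' hnonneg ⟨0, by simp, by simp [hx]⟩
  · refine Finset.sum_pos' hnonneg ⟨n, by simp, ?_⟩
    simp only [pow_mul, Nat.sub_self, Nat.choose_self]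
    positivity

theorem continuous_bernsteinF (n : ℕ) : Continuous (bernsteinF n) := by
  unfold bernsteinF
  fun_prop

/-- If `g` is positive and `g x * g y` is convex on `s ×ˢ s`, then `g` at a midpoint is at most the
geometric mean of its values at the endpoints, so `log ∘ g` is convex. -/
theorem ConvexOn.log_of_mul_prod {s : Set ℝ} {g : ℝ → ℝ} (hs : Convex ℝ s)
    (hg : ContinuousOn g s) (hpos : ∀ x ∈ s, 0 < g x)
    (h : ConvexOn ℝ (s ×ˢ s) fun p : ℝ × ℝ => g p.1 * g p.2) :
    ConvexOn ℝ s fun x => Real.log (g x) := by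
  refine convexOn_of_continuousOn_of_midpoint hs (hg.log fun x hx => (hpos x hx).ne') ?_
  intro x hx y hy
  have hm := hs hx hy (by norm_num : (0 : ℝ) ≤ 1 / 2) (by norm_num : (0 : ℝ) ≤ 1 / 2) (by norm_num)
  have key := h.2 (mk_mem_prod hx hy) (mk_mem_prod hy hx) (by norm_num : (0 : ℝ) ≤ 1 / 2)
    (by norm_num : (0 : ℝ) ≤ 1 / 2) (by norm_num)
  simp only [Prod.smul_mk, Prod.mk_add_mk] at key
  rw [add_comm ((1 / 2 : ℝ) • y)] at key
  have hle : g ((1 / 2 : ℝ) • x + (1 / 2 : ℝ) • y) * g ((1 / 2 : ℝ) • x + (1 / 2 : ℝ) • y)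
      ≤ g x * g y := by
    refine key.trans_eq ?_
    simp only [smul_eq_mul]
    ring
  have hlog := Real.log_le_log (mul_pos (hpos _ hm) (hpos _ hm)) hle
  rw [Real.log_mul (hpos _ hm).ne' (hpos _ hm).ne',
    Real.log_mul (hpos x hx).ne' (hpos y hy).ne'] at hlog
  linarith

theorem ConvexOn.log_mul_prod {s : Set ℝ} {g : ℝ → ℝ} (hpos : ∀ x ∈ s, 0 < g x)
    (h : ConvexOn ℝ s fun x => Real.log (g x)) :
    ConvexOn ℝ (s ×ˢ s) fun p : ℝ × ℝ => Real.log (g p.1 * g p.2) := by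
  have hs := h.1.prod h.1
  have h₁ := (h.comp_linearMap (LinearMap.fst ℝ ℝ ℝ)).subset (fun _ hp => hp.1) hs
  have h₂ := (h.comp_linearMap (LinearMap.snd ℝ ℝ ℝ)).subset (fun _ hp => hp.2) hs
  refine (h₁.add h₂).congr fun p hp => ?_
  exact (Real.log_mul (hpos _ hp.1).ne' (hpos _ hp.2).ne').symm

theorem ConvexOn.of_log {E : Type*} [AddCommGroup E] [Module ℝ E] {s : Set E} {g : E → ℝ}
    (hpos : ∀ x ∈ s, 0 < g x) (h : ConvexOn ℝ s fun x => Real.log (g x)) : ConvexOn ℝ s g := by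
  refine ⟨h.1, fun x hx y hy a b ha hb hab => ?_⟩
  have hz := h.1 hx hy ha hb hab
  calc g (a • x + b • y) = Real.exp (Real.log (g (a • x + b • y))) := (Real.exp_log (hpos _ hz)).symm
    _ ≤ Real.exp (a • Real.log (g x) + b • Real.log (g y)) :=
      Real.exp_le_exp.2 (h.2 hx hy ha hb hab)
    _ ≤ a • Real.exp (Real.log (g x)) + b • Real.exp (Real.log (g y)) :=
      convexOn_exp.2 (mem_univ _) (mem_univ _) ha hb hab
    _ = a • g x + b • g y := by rw [Real.exp_log (hpos x hx), Real.exp_log (hpos y hy)]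

/-- For `Q_n(x,y) = F_n(x)F_n(y)` on `[0,1]²` the following are
equivalent: (i) `log F_n` is convex on `[0,1]`; (ii) `Q_n` is convex on `[0,1]²`;
(iii) `log Q_n` is convex on `[0,1]²`. -/
theorem bernsteinQ_convexity_equivalences (n : ℕ) (hn : 0 < n) :
    (ConvexOn ℝ (Icc (0 : ℝ) 1) (fun x => Real.log (bernsteinF n x)) ↔
      ConvexOn ℝ (Icc (0 : ℝ) 1 ×ˢ Icc (0 : ℝ) 1)
        (fun p : ℝ × ℝ => bernsteinF n p.1 * bernsteinF n p.2)) ∧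
    (ConvexOn ℝ (Icc (0 : ℝ) 1 ×ˢ Icc (0 : ℝ) 1)
        (fun p : ℝ × ℝ => bernsteinF n p.1 * bernsteinF n p.2) ↔
      ConvexOn ℝ (Icc (0 : ℝ) 1 ×ˢ Icc (0 : ℝ) 1)
        (fun p : ℝ × ℝ => Real.log (bernsteinF n p.1 * bernsteinF n p.2))) := by
  have hpos : ∀ x ∈ Icc (0 : ℝ) 1, 0 < bernsteinF n x := fun x _ => bernsteinF_pos n x
  have log_prod := ConvexOn.log_mul_prod (s := Icc 0 1) hpos
  have prod_of_log := ConvexOn.of_log (s := Icc (0 : ℝ) 1 ×ˢ Icc (0 : ℝ) 1)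
    (g := fun p : ℝ × ℝ => bernsteinF n p.1 * bernsteinF n p.2)
    fun p hp => mul_pos (hpos _ hp.1) (hpos _ hp.2)
  have log_of_prod := ConvexOn.log_of_mul_prod (convex_Icc 0 1) (continuous_bernsteinF n).continuousOn
    hpos
  exact ⟨⟨fun h => prod_of_log (log_prod h), log_of_prod⟩, ⟨fun h => log_prod (log_of_prod h), prod_of_log⟩⟩
end
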